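/- For every partition λ and every finite field 𝔽_q, P(s_λ ↦ 0) ≥ 1/q. -/

import Mathlib

open Finset Classical

/-- The Jacobi–Trudi matrix of a partition with `k` parts `lam 0 ≥ lam 1 ≥ …`,
with respect to a 1-indexed assignment `a : ℕ → F` of values to `h_1, h_2, …`.
The `(i,j)` entry (indices `0`-based) is `a (lam i - i + j)` if that subscript is `≥ 1`,
is `1` if it is `0`, and is `0` if it is negative. -/
def JTmat (F : Type*) [Field F] (k : ℕ) (lam : ℕ → ℕ) (a : ℕ → F) :
    Matrix (Fin k) (Fin k) F :=
  Matrix.of fun i j =>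
    if 1 ≤ (lam i : ℤ) - (i : ℤ) + (j : ℤ) then
      a ((lam i : ℤ) - (i : ℤ) + (j : ℤ)).toNat
    else if (lam i : ℤ) - (i : ℤ) + (j : ℤ) = 0 then 1 else 0

/-- Extend a tuple `b : Fin N → F` to a `1`-indexed assignment `ℕ → F`
(zero outside `{1, …, N}`). -/
def extFin {F : Type*} [Zero F] {N : ℕ} (b : Fin N → F) : ℕ → F :=
  fun n => if h : 1 ≤ n ∧ n ≤ N then b ⟨n - 1, by omega⟩ else 0

/-- The probability that the Jacobi–Trudi determinant of the partition `lam`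
(with `k` parts) equals `c`, when the values of `h_1, …, h_N` are chosen
uniformly at random in `F`. -/
noncomputable def probEq (F : Type*) [Field F] [Fintype F]
    (k : ℕ) (lam : ℕ → ℕ) (N : ℕ) (c : F) : ℚ :=
  ((Finset.univ.filter fun b : Fin N → F =>
      (JTmat F k lam (extFin b)).det = c).card : ℚ) / (Fintype.card F : ℚ) ^ N

/-- `lam` records a partition with `k` (positive, weakly decreasing) parts
on the indices `0, …, k-1`. -/
def IsPartition (k : ℕ) (lam : ℕ → ℕ) : Prop :=
  (∀ i, i + 1 < k → lam (i + 1) ≤ lam i) ∧ ∀ i, i < k → 1 ≤ lam i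

/-- If every point `x` comes with a coordinate `T x` that is unchanged when `x` is modified at that
coordinate, and some such modification lands in `P`, then `P` has density at least `1 / |F|`. -/
theorem card_fun_le_mul_card_filter {ι F : Type*} [Fintype ι] [DecidableEq ι] [Fintype F]
    (P : (ι → F) → Prop) (T : (ι → F) → ι)
    (hT : ∀ x v, T (Function.update x (T x) v) = T x)
    (hP : ∀ x, ∃ v, P (Function.update x (T x) v)) :
    Fintype.card (ι → F) ≤ Fintype.card F * (univ.filter P).card := by
  choose v hv using hP
  refine Finset.card_le_mul_card_image_of_maps_to
    (f := fun x => Function.update x (T x) (v x)) (fun x _ => by simpa using hv x) _ ?_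
  intro y _
  calc _ ≤ (univ.image fun w => Function.update y (T y) w).card := by
        refine Finset.card_le_card fun x hx => ?_
        simp only [Finset.mem_filter, Finset.mem_univ, true_and] at hx
        subst hx
        simp only [Finset.mem_image, Finset.mem_univ, true_and, hT]
        exact ⟨x (T x), by simp⟩
    _ ≤ _ := Finset.card_image_le

theorem extFin_update {F : Type*} [Zero F] {N : ℕ} (b : Fin N → F) (t : Fin N) (v : F) :
    extFin (Function.update b t v) = Function.update (extFin b) (t + 1) v := by
  funext n
  by_cases hn : n = t + 1
  · subst hn
    have := t.2
    simp [extFin]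
  · rw [Function.update_of_ne hn]
    unfold extFin
    split_ifs with h
    · rw [Function.update_of_ne]
      rintro rfl
      simp at hn
      omega
    · rfl

theorem JTmat_update_of_lt {F : Type*} [Field F] {k : ℕ} {lam : ℕ → ℕ} (a : ℕ → F) {m : ℕ} (v : F)
    {i j : Fin k} (h : (lam i : ℤ) - i + j < m) :
    JTmat F k lam (Function.update a m v) i j = JTmat F k lam a i j := by
  simp only [JTmat, Matrix.of_apply]
  split_ifs with h1
  · rw [Function.update_of_ne]
    omega
  · rfl
  · rfl

theorem JTmat_update_of_eq {F : Type*} [Field F] {k : ℕ} {lam : ℕ → ℕ} (a : ℕ → F) {m : ℕ} (v : F)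
    {i j : Fin k} (hm : 1 ≤ m) (h : (lam i : ℤ) - i + j = m) :
    JTmat F k lam (Function.update a m v) i j = v := by
  simp only [JTmat, Matrix.of_apply, h]
  simp [hm]

theorem IsPartition.le {k : ℕ} {lam : ℕ → ℕ} (h : IsPartition k lam) {i j : ℕ} (hij : i ≤ j)
    (hj : j < k) : lam j ≤ lam i := by
  induction j, hij using Nat.le_induction with
  | base => exact le_rfl
  | succ n _ ih => exact (h.1 n hj).trans (ih (by omega))

/-- Row `i` of `M`, with its last entry dropped, is a linear combination of the rows below it. -/
def RowDependent {F : Type*} [Field F] {K : ℕ} (M : Matrix (Fin (K + 1)) (Fin (K + 1)) F)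
    (i : Fin (K + 1)) : Prop :=
  ∃ g : Fin (K + 1) → F, g i = 1 ∧ (∀ l < i, g l = 0) ∧
    ∀ j : Fin K, ∑ l, g l * M l j.castSucc = 0

theorem exists_rowDependent {F : Type*} [Field F] {K : ℕ}
    (M : Matrix (Fin (K + 1)) (Fin (K + 1)) F) : ∃ i, RowDependent M i := by
  have hdet : (M.updateCol (Fin.last K) 0).det = 0 :=
    Matrix.det_eq_zero_of_column_eq_zero (Fin.last K) (by simp)
  obtain ⟨g, hg, hgM⟩ := Matrix.exists_vecMul_eq_zero_iff.2 hdet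
  obtain ⟨l, hl⟩ := Function.ne_iff.1 hg
  obtain ⟨i, hi, hmin⟩ := WellFounded.has_min (wellFounded_lt (α := Fin (K + 1)))
    {l | g l ≠ 0} ⟨l, hl⟩
  refine ⟨i, fun l => (g i)⁻¹ * g l, inv_mul_cancel₀ hi, fun l hl => ?_, fun j => ?_⟩
  · have : g l = 0 := by
      by_contra h
      exact hmin l h hl
    simp [this]
  · have := congrFun hgM j.castSucc
    simp only [Matrix.vecMul, dotProduct, Pi.zero_apply,
      Matrix.updateCol_ne (Fin.castSucc_lt_last j).ne] at this
    simp only [mul_assoc, ← Finset.mul_sum, this, mul_zero]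

theorem RowDependent.congr {F : Type*} [Field F] {K : ℕ}
    {M M' : Matrix (Fin (K + 1)) (Fin (K + 1)) F} {i : Fin (K + 1)} (h : RowDependent M i)
    (hM : ∀ l, i ≤ l → ∀ j : Fin K, M' l j.castSucc = M l j.castSucc) : RowDependent M' i := by
  obtain ⟨g, h1, h0, hg⟩ := h
  refine ⟨g, h1, h0, fun j => ?_⟩
  rw [← hg j]
  refine Finset.sum_congr rfl fun l _ => ?_
  rcases lt_or_ge l i with hl | hl
  · simp [h0 l hl]
  · rw [hM l hl]

/-- The last row of `M` that, with its last entry dropped, is a linear combination of the rows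
below it. -/
noncomputable def lastDependentRow {F : Type*} [Field F] {K : ℕ}
    (M : Matrix (Fin (K + 1)) (Fin (K + 1)) F) : Fin (K + 1) :=
  (univ.filter (RowDependent M)).max' ((exists_rowDependent M).imp fun i hi => by simpa using hi)

theorem rowDependent_lastDependentRow {F : Type*} [Field F] {K : ℕ}
    (M : Matrix (Fin (K + 1)) (Fin (K + 1)) F) : RowDependent M (lastDependentRow M) :=
  (Finset.mem_filter.1 (Finset.max'_mem (univ.filter (RowDependent M)) _)).2

theorem RowDependent.le_lastDependentRow {F : Type*} [Field F] {K : ℕ}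
    {M : Matrix (Fin (K + 1)) (Fin (K + 1)) F} {i : Fin (K + 1)} (h : RowDependent M i) :
    i ≤ lastDependentRow M :=
  Finset.le_max' _ _ (by simpa using h)

theorem lastDependentRow_congr {F : Type*} [Field F] {K : ℕ}
    {M M' : Matrix (Fin (K + 1)) (Fin (K + 1)) F}
    (hM : ∀ l, lastDependentRow M ≤ l → ∀ j : Fin K, M' l j.castSucc = M l j.castSucc) :
    lastDependentRow M' = lastDependentRow M := by
  have hle := ((rowDependent_lastDependentRow M).congr hM).le_lastDependentRow
  exact le_antisymm ((rowDependent_lastDependentRow M').congr fun l hl j =>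
    (hM l (hle.trans hl) j).symm).le_lastDependentRow hle

/-- If `M` and `M'` agree from the last dependent row of `M` on, except possibly at the last entry
of that row, then a suitable value of that entry, depending only on `M`, makes `M'` singular. -/
theorem exists_forall_det_eq_zero {F : Type*} [Field F] {K : ℕ}
    (M : Matrix (Fin (K + 1)) (Fin (K + 1)) F) :
    ∃ v, ∀ M' : Matrix (Fin (K + 1)) (Fin (K + 1)) F,
      (∀ l, lastDependentRow M ≤ l → ∀ j : Fin K, M' l j.castSucc = M l j.castSucc) →
      (∀ l, lastDependentRow M < l → M' l (Fin.last K) = M l (Fin.last K)) →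
      M' (lastDependentRow M) (Fin.last K) = v → M'.det = 0 := by
  obtain ⟨g, h1, h0, hg⟩ := rowDependent_lastDependentRow M
  set i := lastDependentRow M
  refine ⟨-∑ l ∈ univ.erase i, g l * M l (Fin.last K), fun M' hM hlast hi => ?_⟩
  refine Matrix.exists_vecMul_eq_zero_iff.1 ⟨g, fun h => by simp [h] at h1, funext fun j => ?_⟩
  simp only [Matrix.vecMul, dotProduct, Pi.zero_apply]
  induction j using Fin.lastCases with
  | last =>
    rw [← Finset.add_sum_erase _ _ (Finset.mem_univ i), hi, h1, one_mul, neg_add_eq_zero]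
    refine Finset.sum_congr rfl fun l hl => ?_
    rcases lt_or_gt_of_ne (Finset.ne_of_mem_erase hl) with hl | hl
    · simp [h0 l hl]
    · rw [hlast l hl]
  | cast j =>
    rw [← hg j]
    refine Finset.sum_congr rfl fun l _ => ?_
    rcases lt_or_ge l i with hl | hl
    · simp [h0 l hl]
    · rw [hM l hl]

/-- For every partition `λ`, `P(s_λ ↦ 0) ≥ 1/q`. -/
theorem prob_zero_ge_inv_q (F : Type*) [Field F] [Fintype F]
    (k : ℕ) (hk : 0 < k) (lam : ℕ → ℕ) (hpart : IsPartition k lam) :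
    1 / (Fintype.card F : ℚ) ≤ probEq F k lam (lam 0 + (k - 1)) 0 := by
  obtain ⟨K, rfl⟩ : ∃ K, k = K + 1 := ⟨k - 1, by omega⟩
  simp only [Nat.add_sub_cancel]
  have hlt (i : Fin (K + 1)) : lam i + K - i - 1 < lam 0 + K := by
    have := hpart.le (Nat.zero_le i) i.2
    have := hpart.2 i i.2
    have := i.2
    omega
  let t (i : Fin (K + 1)) : Fin (lam 0 + K) := ⟨lam i + K - i - 1, hlt i⟩
  have ht (i : Fin (K + 1)) : (((t i : ℕ) + 1 : ℕ) : ℤ) = lam i - i + K := by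
    have := hpart.2 i i.2
    have := i.2
    simp only [t]
    omega
  have hbelow (b : Fin (lam 0 + K) → F) (v : F) {i l : Fin (K + 1)} (hil : i ≤ l) (j : Fin K) :
      JTmat F (K + 1) lam (extFin (Function.update b (t i) v)) l j.castSucc =
        JTmat F (K + 1) lam (extFin b) l j.castSucc := by
    rw [extFin_update, JTmat_update_of_lt]
    have := hpart.le (Fin.le_def.1 hil) l.2
    rw [ht]
    simp only [Fin.val_castSucc]
    omega
  have hcard := card_fun_le_mul_card_filter
    (fun b : Fin (lam 0 + K) → F => (JTmat F (K + 1) lam (extFin b)).det = 0)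
    (fun b => t (lastDependentRow (JTmat F (K + 1) lam (extFin b))))
    (fun b v => congrArg t (lastDependentRow_congr fun l hl j => hbelow b v hl j))
    (fun b => by
      obtain ⟨v, hv⟩ := exists_forall_det_eq_zero (JTmat F (K + 1) lam (extFin b))
      refine ⟨v, hv _ (fun l hl j => hbelow b v hl j) (fun l hl => ?_) ?_⟩
      · rw [extFin_update, JTmat_update_of_lt]
        have := hpart.le (Fin.le_def.1 hl.le) l.2
        have := Fin.lt_def.1 hl
        rw [ht]
        simp only [Fin.val_last]
        omega
      · rw [extFin_update, JTmat_update_of_eq _ _ (Nat.le_add_left _ _)]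
        rw [ht, Fin.val_last])
  have hq : (0 : ℚ) < Fintype.card F := by exact_mod_cast Fintype.card_pos
  rw [Fintype.card_fun, Fintype.card_fin] at hcard
  rw [probEq, div_le_div_iff₀ hq (by positivity), one_mul, mul_comm]
  exact_mod_cast hcard
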